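/- Interchange of sum and tagged mixing (bigmix-sum): for any variable ι ∈ Var, any index set I of values, and families (P_x)_{x∈I}, (Q_x)_{x∈I} of SL propositions, the mutual entailment (⊕^ι_{x∈I} P_x) + (⊕^ι_{x∈I} Q_x) ⟛ ⊕^ι_{x∈I}(P_x + Q_x) holds. -/

import Mathlib

open scoped Classical

noncomputable section

namespace QSL

/-! ## Resources -/

/-- Vectors over the Hilbert space with orthonormal basis indexed by `Q → {0,1}`. -/
def Vec {Qubit : Type} (Q : Finset Qubit) : Type := ({ q // q ∈ Q } → Bool) → ℂ

/-- A quantum state: a finite set of qubits together with a vector over them. -/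
def QState (Qubit : Type) : Type := Σ Q : Finset Qubit, Vec Q

/-- A store: a partial function from variables to values. -/
def Store (Var Val : Type) : Type := Var → Option Val

/-- A resource: a quantum state together with a store. -/
def Res (Qubit Var Val : Type) : Type := QState Qubit × Store Var Val

variable {Qubit Var Val : Type}

/-- Tensor product of vectors over disjoint qubit sets. -/
def tensorVec {Q Q' : Finset Qubit} (v : Vec Q) (w : Vec Q') : Vec (Q ∪ Q') := fun f =>
  v (fun q => f ⟨q.1, Finset.mem_union_left _ q.2⟩) *
  w (fun q => f ⟨q.1, Finset.mem_union_right _ q.2⟩)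

/-- Transport of a vector along an equality of qubit sets. -/
def castVec {Q Q' : Finset Qubit} (h : Q = Q') (v : Vec Q) : Vec Q' := h ▸ v

/-- The empty quantum state with scalar 1. -/
def unitQ : QState Qubit := ⟨(∅ : Finset Qubit), fun _ => 1⟩

/-- The unit resource: empty qubit set with scalar 1 and the empty store. -/
def unitRes : Res Qubit Var Val := (unitQ, fun _ => none)

/-- Partial product of resources: defined iff the qubit sets are disjoint and
the store domains are disjoint; takes the union of qubit sets, tensor product of
vectors, and union of stores. -/
def rmul (a b : Res Qubit Var Val) : Option (Res Qubit Var Val) :=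
  if h : Disjoint a.1.1 b.1.1 ∧ ∀ x, a.2 x = none ∨ b.2 x = none then
    some (⟨a.1.1 ∪ b.1.1, tensorVec a.1.2 b.1.2⟩, fun x => a.2 x <|> b.2 x)
  else none

/-- Partial sum of resources: defined iff the two resources have the same
qubit set and the same store; adds the vectors. -/
def radd (a b : Res Qubit Var Val) : Option (Res Qubit Var Val) :=
  if h : a.1.1 = b.1.1 ∧ a.2 = b.2 then
    some (⟨b.1.1, fun f => castVec h.1 a.1.2 f + b.1.2 f⟩, b.2)
  else none

/-- Incompatibility of resources: some variable lies in both store domains and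
the stores disagree on it. -/
def incompat (a b : Res Qubit Var Val) : Prop :=
  ∃ x u u', a.2 x = some u ∧ b.2 x = some u' ∧ u ≠ u'

/-! ## Multisets (possibly infinite, as families up to bijective reindexing) -/

/-- An indexed family representing a multiset. -/
structure PreMSet (A : Type) : Type 1 where
  idx : Type
  val : idx → A

/-- Equivalence of indexed families by bijective reindexing. -/
def msetEquiv {A : Type} (f g : PreMSet A) : Prop :=
  ∃ e : f.idx ≃ g.idx, ∀ i, f.val i = g.val (e i)

theorem msetEquiv_refl {A : Type} (f : PreMSet A) : msetEquiv f f :=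
  ⟨Equiv.refl _, fun _ => rfl⟩

theorem msetEquiv_symm {A : Type} {f g : PreMSet A} : msetEquiv f g → msetEquiv g f
  | ⟨e, h⟩ => ⟨e.symm, fun i => by rw [h (e.symm i), Equiv.apply_symm_apply]⟩

theorem msetEquiv_trans {A : Type} {f g k : PreMSet A} :
    msetEquiv f g → msetEquiv g k → msetEquiv f k
  | ⟨e, h⟩, ⟨e', h'⟩ => ⟨e.trans e', fun i => (h i).trans (h' (e i))⟩

instance msetSetoid (A : Type) : Setoid (PreMSet A) :=
  ⟨msetEquiv, ⟨msetEquiv_refl, msetEquiv_symm, msetEquiv_trans⟩⟩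

/-- Multisets over `A`: families up to bijective reindexing. -/
def MSet (A : Type) : Type 1 := Quotient (msetSetoid A)

def MSet.mk {A : Type} (I : Type) (f : I → A) : MSet A :=
  Quotient.mk (msetSetoid A) ⟨I, f⟩

/-- A canonical representative family of a multiset. -/
def MSet.out {A : Type} (m : MSet A) : PreMSet A := Quotient.out m

/-- `a` is an occurrence of the multiset `m`. -/
def MSet.MemM {A : Type} (a : A) (m : MSet A) : Prop := ∃ i, m.out.val i = a

def MSet.map {A B : Type} (f : A → B) (m : MSet A) : MSet B :=
  MSet.mk m.out.idx (fun i => f (m.out.val i))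

/-- Sum (disjoint union) of two multisets. -/
def MSet.uplus {A : Type} (m m' : MSet A) : MSet A :=
  MSet.mk (m.out.idx ⊕ m'.out.idx) (Sum.elim m.out.val m'.out.val)

/-- Indexed sum (disjoint union) of a family of multisets. -/
def MSet.biguplus {A : Type} (I : Type) (f : I → MSet A) : MSet A :=
  MSet.mk (Σ x : I, (f x).out.idx) (fun p => (f p.1).out.val p.2)


/-- Partial product of multisets of resources: an occurrence `a·b` for every
pair of occurrences, defined iff all these resource products are defined. -/
def mprodM (m m' : MSet (Res Qubit Var Val)) : Option (MSet (Res Qubit Var Val)) :=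
  if h : ∀ (i : m.out.idx) (j : m'.out.idx), (rmul (m.out.val i) (m'.out.val j)).isSome then
    some (MSet.mk (m.out.idx × m'.out.idx)
      (fun p => (rmul (m.out.val p.1) (m'.out.val p.2)).get (h p.1 p.2)))
  else none

/-- Sum of the two projections of a multiset of pairs of resources (the
multiset of pairs plays the role of a multiset bijection between its two
projections): defined iff all the componentwise resource sums are defined. -/
def msumr (r : MSet (Res Qubit Var Val × Res Qubit Var Val)) :
    Option (MSet (Res Qubit Var Val)) :=
  if h : ∀ i, (radd (r.out.val i).1 (r.out.val i).2).isSome then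
    some (MSet.mk r.out.idx (fun i => (radd (r.out.val i).1 (r.out.val i).2).get (h i)))
  else none

/-! ## SL propositions -/

/-- An SL proposition: a set of multisets of resources. -/
abbrev SLProp (Qubit Var Val : Type) : Type 1 := Set (MSet (Res Qubit Var Val))


/-- Entailment of SL propositions: set inclusion. -/
def entails (P Q : SLProp Qubit Var Val) : Prop := P ⊆ Q

/-- Separating conjunction. -/
def star (P Q : SLProp Qubit Var Val) : SLProp Qubit Var Val :=
  { m | ∃ mp ∈ P, ∃ mq ∈ Q, mprodM mp mq = some m }

/-- Sum of SL propositions: all defined sums `m +_r m'` over `m ∈ P`, `m' ∈ Q`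
and multiset bijections `r` between `m` and `m'`. -/
def propSum (P Q : SLProp Qubit Var Val) : SLProp Qubit Var Val :=
  { m | ∃ r : MSet (Res Qubit Var Val × Res Qubit Var Val),
      MSet.map Prod.fst r ∈ P ∧ MSet.map Prod.snd r ∈ Q ∧ msumr r = some m }

/-- Indexed bare mixing. -/
def bigMix (I : Type) (P : I → SLProp Qubit Var Val) : SLProp Qubit Var Val :=
  { m | ∃ f : I → MSet (Res Qubit Var Val), (∀ x, f x ∈ P x) ∧ m = MSet.biguplus I f }

/-- Binary bare mixing, the case of `bigMix` over a two-element index set. -/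
def binMix (P Q : SLProp Qubit Var Val) : SLProp Qubit Var Val :=
  bigMix Bool (fun b => if b then Q else P)

/-- Precision: any two multisets in `P` are equal. -/
def precise (P : SLProp Qubit Var Val) : Prop := ∀ m ∈ P, ∀ m' ∈ P, m = m'

/-- Non-emptiness of behaviours: every multiset in `P` is nonempty. -/
def nonnb (P : SLProp Qubit Var Val) : Prop := ∀ m ∈ P, Nonempty (MSet.out m).idx

/-- Unambiguity: any two occurrences at distinct indices are incompatible. -/
def unambig (P : SLProp Qubit Var Val) : Prop :=
  ∀ m ∈ P, ∀ i j : (MSet.out m).idx, i ≠ j → incompat (m.out.val i) (m.out.val j)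

/-- Incompatibility of SL propositions: every occurrence of every `m ∈ P` is
incompatible with every occurrence of every `m' ∈ Q`. -/
def propIncompat (P Q : SLProp Qubit Var Val) : Prop :=
  ∀ m ∈ P, ∀ m' ∈ Q, ∀ (i : (MSet.out m).idx) (j : (MSet.out m').idx),
    incompat (m.out.val i) (m'.out.val j)

/-- The singleton proposition of the one-element multiset of a resource. -/
def singletonProp (a : Res Qubit Var Val) : SLProp Qubit Var Val :=
  { m | m = MSet.mk PUnit (fun _ => a) }

/-- The points-to proposition `ι ↦ v`: empty quantum state (scalar 1) and the
store mapping only `ι` to `v`. -/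
def varPoints (ι : Var) (v : Val) : SLProp Qubit Var Val :=
  singletonProp (unitQ, fun y => if y = ι then some v else none)

/-- Tagged mixing over an index set of values. -/
def taggedMix (ι : Var) (I : Set Val) (P : Val → SLProp Qubit Var Val) :
    SLProp Qubit Var Val :=
  bigMix I (fun x => star (varPoints ι x.1) (P x.1))

/-! ## Proof of the interchange law -/

theorem mk_eq_iff {A : Type} {I J : Type} {f : I → A} {g : J → A} :
    MSet.mk I f = MSet.mk J g ↔ ∃ e : I ≃ J, ∀ i, f i = g (e i) :=
  ⟨fun h => Quotient.exact h, fun h => Quotient.sound h⟩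

theorem mk_out {A : Type} (m : MSet A) : MSet.mk m.out.idx m.out.val = m :=
  Quotient.out_eq m

theorem out_mk {A : Type} (I : Type) (f : I → A) :
    ∃ e : (MSet.mk I f).out.idx ≃ I, ∀ i, (MSet.mk I f).out.val i = f (e i) :=
  mk_eq_iff.1 (mk_out (MSet.mk I f))

theorem map_mk {A B : Type} (g : A → B) (I : Type) (f : I → A) :
    MSet.map g (MSet.mk I f) = MSet.mk I (fun i => g (f i)) := by
  obtain ⟨e, he⟩ := out_mk I f
  exact mk_eq_iff.2 ⟨e, fun i => congrArg g (he i)⟩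

/-- Adding the tag `ι ↦ x` to a resource. -/
def tagR (ι : Var) (x : Val) (a : Res Qubit Var Val) : Res Qubit Var Val :=
  (a.1, fun y => if y = ι then some x else a.2 y)

theorem qstate_ext {Q Q' : Finset Qubit} (h : Q' = Q) (w : Vec Q') (v : Vec Q)
    (hw : ∀ f : {q // q ∈ Q'} → Bool, w f = v (fun q => f ⟨q.1, h.symm ▸ q.2⟩)) :
    (⟨Q', w⟩ : QState Qubit) = ⟨Q, v⟩ := by
  subst h
  have : w = v := funext hw
  rw [this]

theorem rmul_tag (ι : Var) (x : Val) (a b : Res Qubit Var Val) :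
    rmul (unitQ, fun y => if y = ι then some x else none) a = some b ↔
      a.2 ι = none ∧ b = tagR ι x a := by
  obtain ⟨⟨Q, v⟩, s⟩ := a
  unfold rmul
  have key : (⟨∅ ∪ Q, tensorVec (fun _ => 1 : Vec (∅ : Finset Qubit)) v⟩ : QState Qubit)
      = ⟨Q, v⟩ := by
    refine qstate_ext (Finset.empty_union Q) _ _ (fun f => ?_)
    simp [tensorVec]
  have key2 : s ι = none → (fun y => (if y = ι then some x else none) <|> s y)
      = (fun y => if y = ι then some x else s y) := by
    intro h
    funext y
    by_cases hy : y = ι <;> simp [hy]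
  by_cases hs : s ι = none
  · rw [dif_pos]
    · have : ((⟨∅ ∪ Q, tensorVec (fun _ => 1 : Vec (∅ : Finset Qubit)) v⟩,
        fun y => (if y = ι then some x else none) <|> s y) : Res Qubit Var Val)
        = tagR ι x (⟨Q, v⟩, s) := Prod.ext key (key2 hs)
      exact ⟨fun h => ⟨hs, (Option.some.inj h).symm.trans this⟩,
        fun h => congrArg some (this.trans h.2.symm)⟩
    · refine ⟨Finset.disjoint_empty_left _, fun y => ?_⟩
      by_cases hy : y = ι
      · right; rw [hy]; exact hs
      · left; simp [hy]
  · rw [dif_neg]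
    · simp [hs]
    · rintro ⟨-, h⟩
      have := h ι
      simp at this
      exact hs this

theorem mprod_eq (I J : Type) (f : I → Res Qubit Var Val) (g : J → Res Qubit Var Val)
    (m : MSet (Res Qubit Var Val)) :
    mprodM (MSet.mk I f) (MSet.mk J g) = some m ↔
      ∃ c : I × J → Res Qubit Var Val, (∀ p, rmul (f p.1) (g p.2) = some (c p)) ∧
        m = MSet.mk (I × J) c := by
  obtain ⟨e, he⟩ := out_mk I f
  obtain ⟨e', he'⟩ := out_mk J g
  unfold mprodM
  constructor
  · intro h
    split_ifs at h with hd
    have hd' : ∀ p : I × J, (rmul (f p.1) (g p.2)).isSome := by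
      intro p
      have := hd (e.symm p.1) (e'.symm p.2)
      simpa [he, he'] using this
    refine ⟨fun p => (rmul (f p.1) (g p.2)).get (hd' p), fun p => by simp, ?_⟩
    rw [← Option.some.inj h]
    refine mk_eq_iff.2 ⟨Equiv.prodCongr e e', fun p => ?_⟩
    simp [he, he']
  · rintro ⟨c, hc, rfl⟩
    have hd : ∀ i j, (rmul ((MSet.mk I f).out.val i) ((MSet.mk J g).out.val j)).isSome := by
      intro i j
      rw [he, he', hc (e i, e' j)]
      rfl
    rw [dif_pos hd]
    refine congrArg some (mk_eq_iff.2 ⟨Equiv.prodCongr e e', fun p => ?_⟩)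
    have := hc (e p.1, e' p.2)
    simp [he, he', this]
    rfl

theorem msumr_eq (J : Type) (a b : J → Res Qubit Var Val) (m : MSet (Res Qubit Var Val)) :
    msumr (MSet.mk J (fun j => (a j, b j))) = some m ↔
      ∃ c : J → Res Qubit Var Val, (∀ j, radd (a j) (b j) = some (c j)) ∧ m = MSet.mk J c := by
  obtain ⟨e, he⟩ := out_mk J (fun j => (a j, b j))
  unfold msumr
  constructor
  · intro h
    split_ifs at h with hd
    have hd' : ∀ j, (radd (a j) (b j)).isSome := by
      intro j
      have := hd (e.symm j)
      simpa [he] using this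
    refine ⟨fun j => (radd (a j) (b j)).get (hd' j), fun p => by simp, ?_⟩
    rw [← Option.some.inj h]
    refine mk_eq_iff.2 ⟨e, fun p => ?_⟩
    simp [he]
  · rintro ⟨c, hc, rfl⟩
    have hd : ∀ i, (radd ((MSet.mk J (fun j => (a j, b j))).out.val i).1
        ((MSet.mk J (fun j => (a j, b j))).out.val i).2).isSome := by
      intro i
      rw [he, hc (e i)]
      rfl
    rw [dif_pos hd]
    refine congrArg some (mk_eq_iff.2 ⟨e, fun p => ?_⟩)
    have := hc (e p)
    simp [he, this]

theorem mem_propSum (P Q : SLProp Qubit Var Val) (m : MSet (Res Qubit Var Val)) :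
    m ∈ propSum P Q ↔ ∃ (J : Type) (a b c : J → Res Qubit Var Val),
      MSet.mk J a ∈ P ∧ MSet.mk J b ∈ Q ∧ (∀ j, radd (a j) (b j) = some (c j)) ∧
      m = MSet.mk J c := by
  constructor
  · rintro ⟨r, h1, h2, h3⟩
    rw [← mk_out r] at h3
    obtain ⟨c, hc, hm⟩ := (msumr_eq r.out.idx (fun i => (r.out.val i).1)
      (fun i => (r.out.val i).2) m).1 h3
    exact ⟨_, _, _, c, h1, h2, hc, hm⟩
  · rintro ⟨J, a, b, c, h1, h2, hc, hm⟩
    refine ⟨MSet.mk J (fun j => (a j, b j)), ?_, ?_, (msumr_eq J a b m).2 ⟨c, hc, hm⟩⟩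
    · rw [map_mk]; exact h1
    · rw [map_mk]; exact h2

theorem mem_star_tag (ι : Var) (x : Val) (P : SLProp Qubit Var Val)
    (m : MSet (Res Qubit Var Val)) :
    m ∈ star (varPoints ι x) P ↔ ∃ (J : Type) (a : J → Res Qubit Var Val),
      MSet.mk J a ∈ P ∧ (∀ j, (a j).2 ι = none) ∧ m = MSet.mk J (fun j => tagR ι x (a j)) := by
  constructor
  · rintro ⟨mp, hp, mq, hq, h⟩
    have hp' : mp = MSet.mk PUnit _ := hp
    rw [hp', ← mk_out mq] at h
    obtain ⟨c, hc, hm⟩ := (mprod_eq _ _ _ _ _).1 h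
    refine ⟨mq.out.idx, mq.out.val, by rw [mk_out]; exact hq,
      fun j => ((rmul_tag _ _ _ _).1 (hc (PUnit.unit, j))).1, ?_⟩
    rw [hm]
    exact mk_eq_iff.2 ⟨Equiv.punitProd _, fun p => ((rmul_tag _ _ _ _).1 (hc p)).2⟩
  · rintro ⟨J, a, h1, h2, h3⟩
    refine ⟨_, rfl, _, h1, (mprod_eq _ _ _ _ _).2 ⟨fun p => tagR ι x (a p.2), fun p =>
      (rmul_tag _ _ _ _).2 ⟨h2 _, rfl⟩, ?_⟩⟩
    rw [h3]
    exact mk_eq_iff.2 ⟨(Equiv.punitProd _).symm, fun p => rfl⟩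

theorem biguplus_mk {A : Type} (I : Type) (J : I → Type) (a : ∀ x, J x → A) :
    MSet.biguplus I (fun x => MSet.mk (J x) (a x)) =
      MSet.mk (Σ x, J x) (fun p => a p.1 p.2) := by
  have h := fun x => out_mk (J x) (a x)
  choose e he using h
  exact mk_eq_iff.2 ⟨Equiv.sigmaCongrRight e, fun p => he p.1 p.2⟩

theorem mem_taggedMix (ι : Var) (I : Set Val) (P : Val → SLProp Qubit Var Val)
    (m : MSet (Res Qubit Var Val)) :
    m ∈ taggedMix ι I P ↔ ∃ (J : I → Type) (a : ∀ x, J x → Res Qubit Var Val),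
      (∀ x : I, MSet.mk (J x) (a x) ∈ P x.1) ∧ (∀ x j, (a x j).2 ι = none) ∧
      m = MSet.mk (Σ x, J x) (fun p => tagR ι p.1.1 (a p.1 p.2)) := by
  constructor
  · rintro ⟨f, hf, rfl⟩
    have h := fun x => (mem_star_tag ι x.1 (P x.1) (f x)).1 (hf x)
    choose J a h1 h2 h3 using h
    refine ⟨J, a, h1, h2, ?_⟩
    rw [← biguplus_mk (↑I) J (fun x j => tagR ι x.1 (a x j))]
    exact congrArg _ (funext h3)
  · rintro ⟨J, a, h1, h2, h3⟩
    refine ⟨fun x => MSet.mk (J x) (fun j => tagR ι x.1 (a x j)), fun x =>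
      (mem_star_tag _ _ _ _).2 ⟨J x, a x, h1 x, h2 x, rfl⟩, ?_⟩
    rw [h3, biguplus_mk]

theorem radd_store {a b c : Res Qubit Var Val} (h : radd a b = some c) :
    a.2 = c.2 ∧ b.2 = c.2 := by
  unfold radd at h
  split_ifs at h with hd
  rw [← Option.some.inj h]
  exact ⟨hd.2, rfl⟩

theorem radd_tag {ι : Var} {x : Val} {a b c : Res Qubit Var Val} (h : radd a b = some c) :
    radd (tagR ι x a) (tagR ι x b) = some (tagR ι x c) := by
  unfold radd at h
  split_ifs at h with hd
  rw [← Option.some.inj h]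
  unfold radd
  rw [dif_pos ⟨hd.1, by simp only [tagR, hd.2]; rfl⟩]
  rfl

theorem radd_untag {ι : Var} {x y : Val} {a b c : Res Qubit Var Val}
    (ha : a.2 ι = none) (hb : b.2 ι = none)
    (h : radd (tagR ι x a) (tagR ι y b) = some c) :
    x = y ∧ ∃ c', radd a b = some c' ∧ c'.2 ι = none ∧ c = tagR ι x c' := by
  unfold radd at h
  split_ifs at h with hd
  obtain ⟨h1, h2⟩ := hd
  have h2' : ∀ z, (if z = ι then some x else a.2 z) = (if z = ι then some y else b.2 z) :=
    fun z => congrFun h2 z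
  have hxy : x = y := by simpa using h2' ι
  have hs : a.2 = b.2 := by
    funext z
    by_cases hz : z = ι
    · rw [hz, ha, hb]
    · simpa [hz] using h2' z
  refine ⟨hxy, (⟨b.1.1, fun f => castVec h1 a.1.2 f + b.1.2 f⟩, b.2), ?_, hb, ?_⟩
  · unfold radd
    rw [dif_pos ⟨h1, hs⟩]
    rfl
  · rw [← Option.some.inj h]
    clear h
    subst hxy
    rfl

theorem fiber_mk {A : Type} {I J : Type} {K : I → Type} (a : ∀ x, K x → A)
    (e : J ≃ Σ x, K x) (x : I) :
    MSet.mk {j // (e j).1 = x} (fun j => a (e j.1).1 (e j.1).2) = MSet.mk (K x) (a x) := by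
  symm
  refine mk_eq_iff.2 ⟨Equiv.ofBijective
    (fun i => ⟨e.symm ⟨x, i⟩, by rw [Equiv.apply_symm_apply]⟩) ⟨?_, ?_⟩, ?_⟩
  · intro i i' h
    have := e.symm.injective (Subtype.ext_iff.1 h)
    simpa using this
  · rintro ⟨j, rfl⟩
    exact ⟨(e j).2, Subtype.ext (e.symm_apply_apply j)⟩
  · intro i
    exact (congrArg (fun p : Σ x, K x => a p.1 p.2) (e.apply_symm_apply ⟨x, i⟩)).symm

/-- Interchange of sum and tagged mixing:
`(⊕^ι_{x∈I} Pₓ) + (⊕^ι_{x∈I} Qₓ) ⟛ ⊕^ι_{x∈I}(Pₓ + Qₓ)`. -/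
theorem bigmix_sum {Qubit Var Val : Type} (ι : Var) (I : Set Val)
    (P Q : Val → SLProp Qubit Var Val) :
    entails (propSum (taggedMix ι I P) (taggedMix ι I Q))
      (taggedMix ι I (fun x => propSum (P x) (Q x)))
    ∧ entails (taggedMix ι I (fun x => propSum (P x) (Q x)))
      (propSum (taggedMix ι I P) (taggedMix ι I Q)) := by
  constructor
  · intro m hm
    obtain ⟨J, a, b, c, ha, hb, hc, rfl⟩ := (mem_propSum _ _ _).1 hm
    obtain ⟨J1, a1, hP, hn1, h1⟩ := (mem_taggedMix _ _ _ _).1 ha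
    obtain ⟨J2, b1, hQ, hn2, h2⟩ := (mem_taggedMix _ _ _ _).1 hb
    obtain ⟨e1, he1⟩ := mk_eq_iff.1 h1
    obtain ⟨e2, he2⟩ := mk_eq_iff.1 h2
    have key := fun j => radd_untag (hn1 (e1 j).1 (e1 j).2) (hn2 (e2 j).1 (e2 j).2)
      (by rw [← he1 j, ← he2 j]; exact hc j)
    choose hx c' hc' hcn hcc using key
    have hx' : ∀ j, (e1 j).1 = (e2 j).1 := fun j => Subtype.ext (hx j)
    refine (mem_taggedMix _ _ _ _).2 ⟨fun x => {j // (e1 j).1 = x}, fun x j => c' j.1,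
      fun x => ?_, fun x j => hcn _, ?_⟩
    · refine (mem_propSum _ _ _).2 ⟨_, fun j => a1 (e1 j.1).1 (e1 j.1).2,
        fun j => b1 (e2 j.1).1 (e2 j.1).2, _, ?_, ?_, fun j => hc' j.1, rfl⟩
      · rw [fiber_mk a1 e1 x]; exact hP x
      · have : MSet.mk {j // (e1 j).1 = x} (fun j => b1 (e2 j.1).1 (e2 j.1).2)
            = MSet.mk {j // (e2 j).1 = x} (fun j => b1 (e2 j.1).1 (e2 j.1).2) :=
          mk_eq_iff.2 ⟨Equiv.subtypeEquivRight (fun j => by rw [hx' j]), fun j => rfl⟩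
        rw [this, fiber_mk b1 e2 x]; exact hQ x
    · refine mk_eq_iff.2 ⟨(Equiv.sigmaFiberEquiv (fun j => (e1 j).1)).symm, fun j => ?_⟩
      exact hcc j
  · intro m hm
    obtain ⟨J, c, hPQ, hn, rfl⟩ := (mem_taggedMix _ _ _ _).1 hm
    have h := fun x => (mem_propSum _ _ _).1 (hPQ x)
    choose K a b d hP hQ hd hcd using h
    have h := fun x => mk_eq_iff.1 (hcd x)
    choose e he using h
    have hdn : ∀ x k, (d x k).2 ι = none := fun x k => by
      have := he x ((e x).symm k)
      rw [Equiv.apply_symm_apply] at this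
      rw [← this]; exact hn _ _
    refine (mem_propSum _ _ _).2 ⟨Σ x, K x, fun p => tagR ι p.1.1 (a p.1 p.2),
      fun p => tagR ι p.1.1 (b p.1 p.2), fun p => tagR ι p.1.1 (d p.1 p.2), ?_, ?_,
      fun p => radd_tag (hd _ _), ?_⟩
    · exact (mem_taggedMix _ _ _ _).2 ⟨K, a, hP, fun x k => by
        rw [(radd_store (hd x k)).1]; exact hdn x k, rfl⟩
    · exact (mem_taggedMix _ _ _ _).2 ⟨K, b, hQ, fun x k => by
        rw [(radd_store (hd x k)).2]; exact hdn x k, rfl⟩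
    · exact mk_eq_iff.2 ⟨Equiv.sigmaCongrRight e, fun p =>
        congrArg (tagR ι p.1.1) (he p.1 p.2)⟩
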